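/- Let θ₁, θ₂ be real numbers such that 1, θ₁, θ₂ are linearly independent over ℤ, let L(x) = x₀ + x₁θ₁ + x₂θ₂, and let (x_ν) be the sequence of minimal points of L. Then there exist infinitely many indices j such that the three vectors x_{j−1}, x_j, x_{j+1} are linearly independent (over ℚ). -/

import Mathlib

/-- Euclidean norm of an integer vector in `ℤ³`. -/
noncomputable def enormZ (v : Fin 3 → ℤ) : ℝ :=
  Real.sqrt ((v 0 : ℝ) ^ 2 + (v 1 : ℝ) ^ 2 + (v 2 : ℝ) ^ 2)

/-- The rational vector associated to an integer vector. -/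
def toQ (v : Fin 3 → ℤ) : Fin 3 → ℚ := fun i => (v i : ℚ)

/-- The value of the linear form `L(x) = x₀ + x₁ θ₁ + x₂ θ₂` at an integer vector. -/
noncomputable def Lv (θ₁ θ₂ : ℝ) (v : Fin 3 → ℤ) : ℝ :=
  (v 0 : ℝ) + (v 1 : ℝ) * θ₁ + (v 2 : ℝ) * θ₂

open scoped Matrix

lemma enormZ_sq (v : Fin 3 → ℤ) :
    enormZ v ^ 2 = (v 0 : ℝ) ^ 2 + (v 1 : ℝ) ^ 2 + (v 2 : ℝ) ^ 2 :=
  Real.sq_sqrt (by positivity)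

lemma enormZ_nonneg (v : Fin 3 → ℤ) : 0 ≤ enormZ v := Real.sqrt_nonneg _

lemma abs_coord_le_enormZ (v : Fin 3 → ℤ) (i : Fin 3) : |(v i : ℝ)| ≤ enormZ v := by
  apply Real.abs_le_sqrt
  fin_cases i <;> simp <;> nlinarith [sq_nonneg (v 0 : ℝ), sq_nonneg (v 1 : ℝ), sq_nonneg (v 2 : ℝ)]

lemma enormZ_le_sum_abs (v : Fin 3 → ℤ) :
    enormZ v ≤ |(v 0 : ℝ)| + |(v 1 : ℝ)| + |(v 2 : ℝ)| := by
  apply Real.sqrt_le_iff.mpr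
  refine ⟨by positivity, ?_⟩
  rw [← sq_abs (v 0 : ℝ), ← sq_abs (v 1 : ℝ), ← sq_abs (v 2 : ℝ)]
  have h0 := abs_nonneg (v 0 : ℝ)
  have h1 := abs_nonneg (v 1 : ℝ)
  have h2 := abs_nonneg (v 2 : ℝ)
  nlinarith [mul_nonneg h0 h1, mul_nonneg h0 h2, mul_nonneg h1 h2]

lemma exists_coord_ne_zero {v : Fin 3 → ℤ} (hv : v ≠ 0) : ∃ k, v k ≠ 0 :=
  Function.ne_iff.mp hv

lemma mul_coord_comm_of_cross_eq_zero {R : Type*} [CommRing R] {u v : Fin 3 → R}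
    (h : u ⨯₃ v = 0) (i k : Fin 3) : u i * v k = u k * v i := by
  have h0 := congrFun h 0
  have h1 := congrFun h 1
  have h2 := congrFun h 2
  simp [cross_apply] at h0 h1 h2
  fin_cases i <;> fin_cases k <;> simp <;> grind

/-- Dirichlet's pigeonhole argument for the linear form `Lv`. -/
lemma exists_abs_Lv_le (θ₁ θ₂ : ℝ) {Q : ℕ} (hQ : 1 ≤ Q) :
    ∃ y : Fin 3 → ℤ, y ≠ 0 ∧ |Lv θ₁ θ₂ y| * (Q : ℝ) ^ 2 ≤ 1 ∧
      enormZ y ≤ (3 + |θ₁| + |θ₂|) * Q := by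
  have hQ' : (1 : ℝ) ≤ Q := by exact_mod_cast hQ
  have hQ2 : (0 : ℝ) < (Q : ℝ) ^ 2 := by positivity
  let u : ℕ × ℕ → ℝ := fun a => a.1 * θ₁ + a.2 * θ₂
  obtain ⟨a, ha, b, hb, hab, hfab⟩ := Finset.exists_ne_map_eq_of_card_lt_of_maps_to
    (s := Finset.range (Q + 1) ×ˢ Finset.range (Q + 1)) (t := Finset.range (Q ^ 2))
    (f := fun a => ⌊Int.fract (u a) * (Q : ℝ) ^ 2⌋₊)
    (by simp only [Finset.card_product, Finset.card_range]; nlinarith)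
    (by
      intro a _
      simp only [Finset.coe_range, Set.mem_Iio]
      rw [Nat.floor_lt (mul_nonneg (Int.fract_nonneg _) hQ2.le)]
      push_cast
      nlinarith [Int.fract_lt_one (u a)])
  simp only [Finset.mem_product, Finset.mem_range] at ha hb
  let y : Fin 3 → ℤ := ![⌊u b⌋ - ⌊u a⌋, (a.1 : ℤ) - b.1, (a.2 : ℤ) - b.2]
  have hL : Lv θ₁ θ₂ y = Int.fract (u a) - Int.fract (u b) := by
    simp only [Lv, y, Int.fract, u, Matrix.cons_val]
    push_cast
    ring
  have hLQ : |Lv θ₁ θ₂ y| * (Q : ℝ) ^ 2 ≤ 1 := by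
    have h1 := Nat.floor_le (mul_nonneg (Int.fract_nonneg (u a)) hQ2.le)
    have h2 := Nat.lt_floor_add_one (Int.fract (u a) * (Q : ℝ) ^ 2)
    have h3 := Nat.floor_le (mul_nonneg (Int.fract_nonneg (u b)) hQ2.le)
    have h4 := Nat.lt_floor_add_one (Int.fract (u b) * (Q : ℝ) ^ 2)
    rw [hfab] at h1 h2
    rw [hL, ← abs_of_pos hQ2, ← abs_mul, abs_le, sub_mul]
    constructor <;> linarith
  refine ⟨y, ?_, hLQ, ?_⟩
  · intro hy
    have h1 := congrFun hy 1
    have h2 := congrFun hy 2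
    simp [y] at h1 h2
    exact hab (Prod.ext (by omega) (by omega))
  · have h1 : |(y 1 : ℝ)| ≤ Q := by
      have : |y 1| ≤ Q := by simp only [y, Matrix.cons_val]; rw [abs_le]; omega
      exact_mod_cast this
    have h2 : |(y 2 : ℝ)| ≤ Q := by
      have : |y 2| ≤ Q := by simp only [y, Matrix.cons_val]; rw [abs_le]; omega
      exact_mod_cast this
    have hL1 : |Lv θ₁ θ₂ y| ≤ 1 := by
      nlinarith [abs_nonneg (Lv θ₁ θ₂ y), one_le_pow₀ hQ' (n := 2)]
    have h0 : |(y 0 : ℝ)| ≤ |Lv θ₁ θ₂ y| + |(y 1 : ℝ)| * |θ₁| + |(y 2 : ℝ)| * |θ₂| := by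
      have : (y 0 : ℝ) = Lv θ₁ θ₂ y - y 1 * θ₁ - y 2 * θ₂ := by simp only [Lv]; ring
      rw [this, ← abs_mul, ← abs_mul]
      exact (abs_sub _ _).trans (by gcongr; exact abs_sub _ _)
    have h3 := mul_le_mul_of_nonneg_right h1 (abs_nonneg θ₁)
    have h4 := mul_le_mul_of_nonneg_right h2 (abs_nonneg θ₂)
    linarith [enormZ_le_sum_abs y]

/-- A lower bound for `|Lv|` on all nonzero integer points of norm `< X` is `O(X⁻²)`. -/
lemma mul_sq_le_of_forall_le_abs_Lv {θ₁ θ₂ l X : ℝ} (hX : 3 + |θ₁| + |θ₂| < X) (hl : 0 ≤ l)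
    (h : ∀ y : Fin 3 → ℤ, y ≠ 0 → enormZ y < X → l ≤ |Lv θ₁ θ₂ y|) :
    l * X ^ 2 ≤ 4 * (3 + |θ₁| + |θ₂|) ^ 2 := by
  set C := 3 + |θ₁| + |θ₂|
  have hC : 0 < C := by positivity
  have hXC : 1 < X / C := (one_lt_div hC).mpr hX
  have hceil : 1 < ⌈X / C⌉₊ := Nat.lt_ceil.mpr (by exact_mod_cast hXC)
  obtain ⟨Q, hQ⟩ : ∃ Q, ⌈X / C⌉₊ = Q + 1 := ⟨⌈X / C⌉₊ - 1, by omega⟩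
  have hQ1 : 1 ≤ Q := by omega
  have hQ1' : (1 : ℝ) ≤ Q := by exact_mod_cast hQ1
  have hlt : (Q : ℝ) < X / C := Nat.lt_ceil.mp (by omega)
  have hle : X / C ≤ Q + 1 := by
    have := Nat.le_ceil (X / C)
    rw [hQ] at this
    exact_mod_cast this
  rw [lt_div_iff₀ hC] at hlt
  rw [div_le_iff₀ hC] at hle
  obtain ⟨y, hy, hyL, hyX⟩ := exists_abs_Lv_le θ₁ θ₂ hQ1
  have hly := h y hy (by linarith)
  have hX2 : X ≤ 2 * C * Q := by nlinarith
  calc l * X ^ 2 ≤ l * (2 * C * Q) ^ 2 := by gcongr; linarith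
    _ = 4 * C ^ 2 * (l * (Q : ℝ) ^ 2) := by ring
    _ ≤ 4 * C ^ 2 * (|Lv θ₁ θ₂ y| * (Q : ℝ) ^ 2) := by gcongr
    _ ≤ 4 * C ^ 2 * 1 := by gcongr
    _ = 4 * C ^ 2 := mul_one _

lemma cross_ne_zero_of_enormZ_lt_of_Lv_lt {θ₁ θ₂ : ℝ} {u v : Fin 3 → ℤ} (hu : u ≠ 0)
    (hv : 0 < Lv θ₁ θ₂ v) (hnorm : enormZ u < enormZ v) (hL : Lv θ₁ θ₂ v < Lv θ₁ θ₂ u) :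
    u ⨯₃ v ≠ 0 := by
  intro h
  obtain ⟨k, hk⟩ := exists_coord_ne_zero hu
  have hc : ∀ i, (u k : ℝ) * v i = v k * u i := fun i => by
    have := mul_coord_comm_of_cross_eq_zero h k i
    rw [mul_comm (v k : ℝ)]
    exact_mod_cast this
  have hk' : (0 : ℝ) < (u k : ℝ) ^ 2 := by positivity
  have hE : (u k : ℝ) ^ 2 * enormZ v ^ 2 = (v k : ℝ) ^ 2 * enormZ u ^ 2 := by
    simp only [enormZ_sq, mul_add, ← mul_pow, hc]
  have hLL : (u k : ℝ) ^ 2 * Lv θ₁ θ₂ v ^ 2 = (v k : ℝ) ^ 2 * Lv θ₁ θ₂ u ^ 2 := by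
    have : (u k : ℝ) * Lv θ₁ θ₂ v = v k * Lv θ₁ θ₂ u := by
      simp only [Lv, mul_add, ← mul_assoc, hc]
    rw [← mul_pow, ← mul_pow, this]
  have h1 : enormZ u ^ 2 < enormZ v ^ 2 := pow_lt_pow_left₀ hnorm (enormZ_nonneg u) two_ne_zero
  have h2 : Lv θ₁ θ₂ v ^ 2 < Lv θ₁ θ₂ u ^ 2 := pow_lt_pow_left₀ hL hv.le two_ne_zero
  rcases le_total ((u k : ℝ) ^ 2) ((v k : ℝ) ^ 2) with h3 | h3
  · nlinarith [sq_nonneg (Lv θ₁ θ₂ u)]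
  · nlinarith [sq_nonneg (enormZ u)]

/-- Nonzero integer vectors on a fixed line through the origin and an integer point stay away from
the line spanned by `(1, θ₁, θ₂)`. -/
lemma exists_pos_le_of_cross_eq_zero {θ₁ θ₂ : ℝ}
    (hind : ∀ a b c : ℤ, (a : ℝ) + (b : ℝ) * θ₁ + (c : ℝ) * θ₂ = 0 → a = 0 ∧ b = 0 ∧ c = 0)
    {w : Fin 3 → ℤ} (hw : w ≠ 0) :
    ∃ c : ℝ, 0 < c ∧ ∀ p : Fin 3 → ℤ, p ≠ 0 → p ⨯₃ w = 0 →
      c ≤ |p 0 * θ₁ - p 1| + |p 0 * θ₂ - p 2| := by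
  have hM : 0 < enormZ w := by
    obtain ⟨k, hk⟩ := exists_coord_ne_zero hw
    exact (abs_pos.mpr (by exact_mod_cast hk)).trans_le (abs_coord_le_enormZ w k)
  have hD : 0 < |w 0 * θ₁ - w 1| + |w 0 * θ₂ - w 2| := by
    by_contra hneg
    have h1 : (w 0 : ℝ) * θ₁ - w 1 = 0 := abs_eq_zero.mp
      (by linarith [abs_nonneg (w 0 * θ₁ - w 1), abs_nonneg (w 0 * θ₂ - w 2)])
    have h2 : (w 0 : ℝ) * θ₂ - w 2 = 0 := abs_eq_zero.mp
      (by linarith [abs_nonneg (w 0 * θ₁ - w 1), abs_nonneg (w 0 * θ₂ - w 2)])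
    have e1 := hind (-w 1) (w 0) 0 (by push_cast; linarith)
    have e2 := hind (-w 2) 0 (w 0) (by push_cast; linarith)
    apply hw
    ext i
    fin_cases i <;> simp <;> omega
  refine ⟨_, div_pos hD hM, fun p hp hpw => ?_⟩
  obtain ⟨k, hk⟩ := exists_coord_ne_zero hp
  have hc : ∀ i, (p i : ℝ) * w k = p k * w i := fun i => by
    exact_mod_cast mul_coord_comm_of_cross_eq_zero hpw i k
  have hk1 : (1 : ℝ) ≤ |(p k : ℝ)| := by exact_mod_cast Int.one_le_abs hk
  have key : ∀ (t : ℝ) (i : Fin 3),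
      |w 0 * t - w i| ≤ |p 0 * t - p i| * enormZ w := fun t i => by
    have e : (p k : ℝ) * (w 0 * t - w i) = (p 0 * t - p i) * w k := by
      linear_combination (-t) * hc 0 + hc i
    calc |w 0 * t - w i| ≤ |(p k : ℝ)| * |w 0 * t - w i| :=
          le_mul_of_one_le_left (abs_nonneg _) hk1
      _ = |p 0 * t - p i| * |(w k : ℝ)| := by rw [← abs_mul, e, abs_mul]
      _ ≤ |p 0 * t - p i| * enormZ w := by gcongr; exact abs_coord_le_enormZ w k
  rw [div_le_iff₀ hM, add_mul]
  exact add_le_add (key θ₁ 1) (key θ₂ 2)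

lemma abs_cross_le {θ₁ θ₂ : ℝ} {u v : Fin 3 → ℤ} (hv : 0 < Lv θ₁ θ₂ v)
    (hnorm : enormZ u < enormZ v) (hL : Lv θ₁ θ₂ v < Lv θ₁ θ₂ u) :
    |(u ⨯₃ v) 0 * θ₁ - (u ⨯₃ v) 1| + |(u ⨯₃ v) 0 * θ₂ - (u ⨯₃ v) 2| ≤
      4 * (Lv θ₁ θ₂ u * enormZ v) := by
  have key : ∀ i, |v i * Lv θ₁ θ₂ u - u i * Lv θ₁ θ₂ v| ≤ 2 * (Lv θ₁ θ₂ u * enormZ v) := by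
    intro i
    have h1 : |(v i : ℝ)| * Lv θ₁ θ₂ u ≤ enormZ v * Lv θ₁ θ₂ u :=
      mul_le_mul_of_nonneg_right (abs_coord_le_enormZ v i) (by linarith)
    have h2 : |(u i : ℝ)| * Lv θ₁ θ₂ v ≤ enormZ v * Lv θ₁ θ₂ u :=
      mul_le_mul ((abs_coord_le_enormZ u i).trans hnorm.le) hL.le hv.le (enormZ_nonneg v)
    have h3 := abs_sub (v i * Lv θ₁ θ₂ u) (u i * Lv θ₁ θ₂ v)
    rw [abs_mul, abs_mul, abs_of_pos hv, abs_of_pos (hv.trans hL)] at h3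
    linarith
  have e1 : (((u ⨯₃ v) 0 : ℤ) : ℝ) * θ₁ - ((u ⨯₃ v) 1 : ℤ)
      = v 2 * Lv θ₁ θ₂ u - u 2 * Lv θ₁ θ₂ v := by
    simp [cross_apply, Lv]; ring
  have e2 : (((u ⨯₃ v) 0 : ℤ) : ℝ) * θ₂ - ((u ⨯₃ v) 2 : ℤ)
      = -(v 1 * Lv θ₁ θ₂ u - u 1 * Lv θ₁ θ₂ v) := by
    simp [cross_apply, Lv]; ring
  rw [e1, e2, abs_neg]
  linarith [key 1, key 2]

lemma cross_dotProduct_eq_zero_of_not_linearIndependent {u v w : Fin 3 → ℤ}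
    (h : ¬ LinearIndependent ℚ ![toQ u, toQ v, toQ w]) : (u ⨯₃ v) ⬝ᵥ w = 0 := by
  by_contra hne
  apply h
  have hdet : (Matrix.of ![toQ u, toQ v, toQ w]).det = (((u ⨯₃ v) ⬝ᵥ w : ℤ) : ℚ) := by
    simp [Matrix.det_fin_three, cross_apply, toQ, dotProduct, Fin.sum_univ_three]
    ring
  have : IsUnit (Matrix.of ![toQ u, toQ v, toQ w]) := by
    rw [Matrix.isUnit_iff_isUnit_det, hdet, isUnit_iff_ne_zero]
    exact_mod_cast hne
  exact Matrix.linearIndependent_rows_iff_isUnit.mpr this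

lemma cross_cross_eq_zero {u v w : Fin 3 → ℤ} (hu : w ⬝ᵥ u = 0) (hv : w ⬝ᵥ v = 0) :
    (u ⨯₃ v) ⨯₃ w = 0 := by
  simp only [dotProduct, Fin.sum_univ_three] at hu hv
  ext i
  fin_cases i <;> simp [cross_apply] <;> grind

lemma dotProduct_eq_zero_of_cross_eq_zero {p w y : Fin 3 → ℤ} (hp : p ≠ 0)
    (h : p ⨯₃ w = 0) (hy : p ⬝ᵥ y = 0) : w ⬝ᵥ y = 0 := by
  obtain ⟨k, hk⟩ := exists_coord_ne_zero hp
  have hc := fun i => mul_coord_comm_of_cross_eq_zero h i k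
  refine (mul_eq_zero.mp ?_).resolve_left hk
  simp only [dotProduct, Fin.sum_univ_three] at hy ⊢
  linear_combination w k * hy - y 0 * hc 0 - y 1 * hc 1 - y 2 * hc 2

lemma natCast_le_enormZ_sq {x : ℕ → Fin 3 → ℤ}
    (h : ∀ ν, enormZ (x ν) < enormZ (x (ν + 1))) (n : ℕ) : (n : ℝ) ≤ enormZ (x n) ^ 2 := by
  induction n with
  | zero => simpa using sq_nonneg _
  | succ n ih =>
    have hlt := pow_lt_pow_left₀ (h n) (enormZ_nonneg _) two_ne_zero
    rw [enormZ_sq] at ih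
    rw [enormZ_sq, enormZ_sq] at hlt
    rw [enormZ_sq]
    norm_cast at *
    omega

/-- Jarník's lemma: along the sequence of minimal points of the linear form
`L(x) = x₀ + x₁θ₁ + x₂θ₂` (with `1, θ₁, θ₂` linearly independent over `ℤ`) there are
infinitely many indices `j` such that `x_{j−1}, x_j, x_{j+1}` are linearly independent. -/
theorem infinitely_many_independent_triples (θ₁ θ₂ : ℝ)
    (hind : ∀ a b c : ℤ, (a : ℝ) + (b : ℝ) * θ₁ + (c : ℝ) * θ₂ = 0 → a = 0 ∧ b = 0 ∧ c = 0)
    -- `x` is the sequence of minimal points (best approximations) of `L`: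
    (x : ℕ → Fin 3 → ℤ)
    (hx0 : ∀ ν, x ν ≠ 0)
    (hLpos : ∀ ν, 0 < Lv θ₁ θ₂ (x ν))
    (hXlt : ∀ ν, enormZ (x ν) < enormZ (x (ν + 1)))
    (hLlt : ∀ ν, Lv θ₁ θ₂ (x (ν + 1)) < Lv θ₁ θ₂ (x ν))
    (hbest : ∀ ν, ∀ y : Fin 3 → ℤ, y ≠ 0 → enormZ y < enormZ (x (ν + 1)) →
      Lv θ₁ θ₂ (x ν) ≤ |Lv θ₁ θ₂ y|)
    : ∀ N : ℕ, ∃ j, N ≤ j ∧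
      LinearIndependent ℚ ![toQ (x (j - 1)), toQ (x j), toQ (x (j + 1))] := by
  intro N
  by_contra! hdep
  have hcross : ∀ ν, x ν ⨯₃ x (ν + 1) ≠ 0 := fun ν =>
    cross_ne_zero_of_enormZ_lt_of_Lv_lt (hx0 ν) (hLpos (ν + 1)) (hXlt ν) (hLlt ν)
  set w := x N ⨯₃ x (N + 1)
  have hplane : ∀ n, w ⬝ᵥ x (N + n) = 0 ∧ w ⬝ᵥ x (N + n + 1) = 0 := by
    intro n
    induction n with
    | zero =>
      rw [dotProduct_comm w, dotProduct_comm w]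
      exact ⟨dot_self_cross _ _, dot_cross_self _ _⟩
    | succ n ih =>
      exact ⟨ih.2, dotProduct_eq_zero_of_cross_eq_zero (hcross (N + n))
        (cross_cross_eq_zero ih.1 ih.2)
        (cross_dotProduct_eq_zero_of_not_linearIndependent (hdep (N + n + 1) (by omega)))⟩
  obtain ⟨c, hc, hlow⟩ := exists_pos_le_of_cross_eq_zero hind (hcross N)
  set C := 3 + |θ₁| + |θ₂|
  have hCpos : 0 < C := by positivity
  set B := C + 16 * C ^ 2 / c
  obtain ⟨n, hn⟩ := exists_nat_gt (B ^ 2)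
  set X := enormZ (x (N + n + 1))
  set l := Lv θ₁ θ₂ (x (N + n))
  have hBX : B < X := by
    refine lt_of_pow_lt_pow_left₀ 2 (enormZ_nonneg _) (hn.trans_le ?_)
    refine le_trans ?_ (natCast_le_enormZ_sq hXlt (N + n + 1))
    exact_mod_cast (by omega : n ≤ N + n + 1)
  have hCX : C < X := lt_of_le_of_lt (le_add_of_nonneg_right (by positivity)) hBX
  have hup : l * X ^ 2 ≤ 4 * C ^ 2 :=
    mul_sq_le_of_forall_le_abs_Lv hCX (hLpos _).le (hbest (N + n))
  have hlX : c ≤ 4 * (l * X) :=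
    (hlow _ (hcross (N + n)) (cross_cross_eq_zero (hplane n).1 (hplane n).2)).trans
      (abs_cross_le (hLpos _) (hXlt _) (hLlt _))
  have hcX : 16 * C ^ 2 < c * X := by
    have : 16 * C ^ 2 / c < X := by linarith
    rwa [div_lt_iff₀ hc, mul_comm X] at this
  nlinarith [mul_le_mul_of_nonneg_right hlX (hCpos.trans hCX).le]
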